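/- Let f : ℝ^m → ℝ ∪ {+∞} be a symmetric function, i.e., invariant under all permutations of coordinates, and define the associated spectral function F : S^m → ℝ ∪ {+∞} by F(Σ) := f(λ(Σ)), where λ(Σ) is the vector of eigenvalues of Σ in nonincreasing order. Then f is proper convex and lower semicontinuous on ℝ^m if and only if F is proper convex and lower semicontinuous on S^m. -/

import Mathlib

open Matrix

namespace Entropic

abbrev Mat (m : ℕ) := Matrix (Fin m) (Fin m) ℝ

/-- A convex, permutation-invariant function decreases under doubly stochastic matrices. -/
lemma apply_mulVec_le_of_mem_doublyStochastic {n : Type*} [Fintype n] [DecidableEq n]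
    {f : (n → ℝ) → EReal} (hsymm : ∀ (σ : Equiv.Perm n) (x : n → ℝ), f (x ∘ σ) = f x)
    (hconv : ∀ x y : n → ℝ, ∀ a b : ℝ, 0 ≤ a → 0 ≤ b → a + b = 1 →
      f (a • x + b • y) ≤ (a : EReal) * f x + (b : EReal) * f y)
    {D : Matrix n n ℝ} (hD : D ∈ doublyStochastic ℝ n) (x : n → ℝ) :
    f (D *ᵥ x) ≤ f x := by
  have hsub : Convex ℝ {y | f y ≤ f x} := by
    intro y hy z hz a b ha hb hab
    refine (hconv y z a b ha hb hab).trans ?_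
    have ha' : (0 : EReal) ≤ a := by exact_mod_cast ha
    have hb' : (0 : EReal) ≤ b := by exact_mod_cast hb
    calc (a : EReal) * f y + (b : EReal) * f z
        ≤ (a : EReal) * f x + (b : EReal) * f x :=
          add_le_add (mul_le_mul_of_nonneg_left hy ha') (mul_le_mul_of_nonneg_left hz hb')
      _ = f x := by
          rw [← EReal.right_distrib_of_nonneg ha' hb', ← EReal.coe_add, hab, EReal.coe_one,
            one_mul]
  obtain ⟨w, hw, hw1, rfl⟩ := exists_eq_sum_perm_of_mem_doublyStochastic hD
  rw [Matrix.sum_mulVec]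
  simp only [Matrix.smul_mulVec, Matrix.permMatrix_mulVec]
  exact hsub.sum_mem (fun σ _ => hw σ) hw1 fun σ _ => (hsymm σ x).le

/-- The entrywise square of a real orthogonal matrix is doubly stochastic. -/
lemma sq_mem_doublyStochastic_of_mem_unitaryGroup {n : Type*} [Fintype n] [DecidableEq n]
    {W : Matrix n n ℝ} (hW : W ∈ unitaryGroup n ℝ) :
    (Matrix.of fun i j => W i j ^ 2) ∈ doublyStochastic ℝ n := by
  rw [mem_doublyStochastic_iff_sum]
  refine ⟨fun i j => sq_nonneg _, fun i => ?_, fun j => ?_⟩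
  · have h := congrFun (congrFun (mem_unitaryGroup_iff.1 hW) i) i
    simpa [Matrix.mul_apply, star_apply, sq] using h
  · have h := congrFun (congrFun (mem_unitaryGroup_iff'.1 hW) j) j
    simpa [Matrix.mul_apply, star_apply, sq] using h

/-- The diagonal of a Hermitian matrix in any orthonormal basis is the image of its eigenvalues
under a doubly stochastic matrix (Schur). -/
lemma exists_diag_conj_eq_mulVec_eigenvalues {n : Type*} [Fintype n] [DecidableEq n]
    {P : Matrix n n ℝ} (hP : P.IsHermitian) {U : Matrix n n ℝ} (hU : U ∈ unitaryGroup n ℝ) :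
    ∃ D ∈ doublyStochastic ℝ n, (star U * P * U).diag = D *ᵥ hP.eigenvalues := by
  let V : unitaryGroup n ℝ := hP.eigenvectorUnitary
  have hW : star U * (V : Matrix n n ℝ) ∈ unitaryGroup n ℝ :=
    mul_mem (Unitary.star_mem hU) V.2
  refine ⟨_, sq_mem_doublyStochastic_of_mem_unitaryGroup hW, ?_⟩
  have h : star U * P * U = (star U * (V : Matrix n n ℝ)) * diagonal hP.eigenvalues *
      star (star U * (V : Matrix n n ℝ)) := by
    conv_lhs => rw [hP.spectral_theorem, Unitary.conjStarAlgAut_apply]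
    simp only [star_mul, star_star, mul_assoc]
    rfl
  ext i
  rw [h, diag_apply, Matrix.mul_apply]
  simp only [mul_diagonal, mulVec, dotProduct, of_apply, star_apply, star_trivial]
  exact Finset.sum_congr rfl fun j _ => by ring

/-- The eigenvalues of a Hermitian matrix are its diagonal in its eigenbasis. -/
lemma diag_conj_eigenvectorUnitary {n : Type*} [Fintype n] [DecidableEq n]
    {P : Matrix n n ℝ} (hP : P.IsHermitian) :
    (star (hP.eigenvectorUnitary : Matrix n n ℝ) * P * hP.eigenvectorUnitary).diag =
      hP.eigenvalues := by
  have h := hP.conjStarAlgAut_star_eigenvectorUnitary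
  rw [Unitary.conjStarAlgAut_apply] at h
  simp only [Unitary.coe_star, star_star] at h
  rw [h, diag_diagonal]
  rfl

/-- Two families over a finite type with the same multiset of values differ by a permutation. -/
lemma exists_perm_eq_comp_of_map_univ_eq {n α : Type*} [Fintype n] [DecidableEq α] {f g : n → α}
    (h : (Finset.univ : Finset n).val.map f = (Finset.univ : Finset n).val.map g) :
    ∃ σ : Equiv.Perm n, f = g ∘ σ := by
  have hcard : ∀ c, Nonempty ({i // f i = c} ≃ {i // g i = c}) := fun c => by
    have h' := congrArg (Multiset.count c) h
    rw [Multiset.count_map, Multiset.count_map] at h'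
    refine ⟨Fintype.equivOfCardEq ?_⟩
    rw [Fintype.card_subtype, Fintype.card_subtype]
    simpa only [Finset.card_def, Finset.filter_val, eq_comm (a := c)] using h'
  let e := fun c => (hcard c).some
  exact ⟨Equiv.ofFiberEquiv e, funext fun i => (Equiv.ofFiberEquiv_map e i).symm⟩

/-- The eigenvalues of a diagonal matrix are its diagonal entries, up to order. -/
lemma exists_eigenvalues_diagonal_eq_comp {n : Type*} [Fintype n] [DecidableEq n] (x : n → ℝ)
    (h : (diagonal x).IsHermitian) : ∃ σ : Equiv.Perm n, h.eigenvalues = x ∘ σ := by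
  apply exists_perm_eq_comp_of_map_univ_eq
  have h₁ := h.roots_charpoly_eq_eigenvalues
  rw [charpoly_diagonal, Polynomial.roots_prod _ _
    (Finset.prod_ne_zero_iff.2 fun i _ => Polynomial.X_sub_C_ne_zero _)] at h₁
  simpa using h₁.symm

/-- Theorem `th:speccconv`, convexity of spectral functions. Let
`f : ℝ^m → ℝ ∪ {+∞}` be symmetric (permutation invariant) and let `F(Σ) := f(λ(Σ))` be
the associated spectral function on `S^m` (by permutation invariance of `f`, the order of
the eigenvalues is immaterial). Then `f` is proper convex and lower semicontinuous on
`ℝ^m` iff `F` is proper convex and lower semicontinuous on `S^m`. -/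
theorem spectral_function_convex_lsc_iff {m : ℕ} (f : (Fin m → ℝ) → EReal)
    (hf_ne_bot : ∀ x, f x ≠ ⊥)
    (hsymm : ∀ (σ : Equiv.Perm (Fin m)) (x : Fin m → ℝ), f (x ∘ σ) = f x)
    (F : Mat m → EReal)
    (hF : ∀ (P : Mat m) (h : P.IsHermitian), F P = f h.eigenvalues) :
    ((∃ x : Fin m → ℝ, f x ≠ ⊤) ∧
      (∀ x y : Fin m → ℝ, ∀ a b : ℝ, 0 ≤ a → 0 ≤ b → a + b = 1 →
        f (a • x + b • y) ≤ (a : EReal) * f x + (b : EReal) * f y) ∧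
      LowerSemicontinuous f) ↔
    ((∃ P : Mat m, P.IsHermitian ∧ F P ≠ ⊤) ∧
      (∀ P Q : Mat m, P.IsHermitian → Q.IsHermitian → ∀ a b : ℝ, 0 ≤ a → 0 ≤ b →
        a + b = 1 → F (a • P + b • Q) ≤ (a : EReal) * F P + (b : EReal) * F Q) ∧
      LowerSemicontinuousOn F {P : Mat m | P.IsHermitian}) := by
  have hdiag : ∀ x : Fin m → ℝ, F (diagonal x) = f x := fun x => by
    obtain ⟨σ, hσ⟩ := exists_eigenvalues_diagonal_eq_comp x (isHermitian_diagonal x)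
    rw [hF _ (isHermitian_diagonal x), hσ, hsymm]
  constructor
  · rintro ⟨⟨x, hx⟩, hconv, hlsc⟩
    have hle : ∀ {P U : Mat m}, P.IsHermitian → U ∈ unitaryGroup (Fin m) ℝ →
        f (star U * P * U).diag ≤ F P := fun {P U} hP hU => by
      obtain ⟨D, hD, h⟩ := exists_diag_conj_eq_mulVec_eigenvalues hP hU
      rw [h, hF P hP]
      exact apply_mulVec_le_of_mem_doublyStochastic hsymm hconv hD _
    refine ⟨⟨diagonal x, isHermitian_diagonal x, by rwa [hdiag]⟩, ?_, ?_⟩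
    · intro P Q hP hQ a b ha hb hab
      have hR : (a • P + b • Q).IsHermitian :=
        (hP.smul (IsSelfAdjoint.all a)).add (hQ.smul (IsSelfAdjoint.all b))
      have hU := hR.eigenvectorUnitary.2
      rw [hF _ hR, ← diag_conj_eigenvectorUnitary hR]
      simp only [mul_add, add_mul, mul_smul_comm, smul_mul_assoc, diag_add, diag_smul]
      exact (hconv _ _ a b ha hb hab).trans <| add_le_add
        (mul_le_mul_of_nonneg_left (hle hP hU) (EReal.coe_nonneg.2 ha))
        (mul_le_mul_of_nonneg_left (hle hQ hU) (EReal.coe_nonneg.2 hb))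
    · intro P hP c hc
      have hP' : P.IsHermitian := hP
      let U : Mat m := hP'.eigenvectorUnitary
      have hcont : Continuous fun Q : Mat m => (star U * Q * U).diag := by fun_prop
      rw [hF P hP', ← diag_conj_eigenvectorUnitary hP'] at hc
      filter_upwards [(hlsc.comp hcont).lowerSemicontinuousWithinAt _ P c hc,
        self_mem_nhdsWithin] with Q hQ hQ'
      exact lt_of_lt_of_le hQ (hle hQ' hP'.eigenvectorUnitary.2)
  · rintro ⟨⟨P, hP, hPF⟩, hconv, hlsc⟩
    refine ⟨⟨hP.eigenvalues, by rwa [← hF P hP]⟩, fun x y a b ha hb hab => ?_, ?_⟩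
    · have h := hconv _ _ (isHermitian_diagonal x) (isHermitian_diagonal y) a b ha hb hab
      rwa [← diagonal_smul, ← diagonal_smul, diagonal_add, hdiag, hdiag, hdiag] at h
    · have hcomp : F ∘ diagonal = f := funext hdiag
      rw [← hcomp, ← lowerSemicontinuousOn_univ_iff]
      exact hlsc.comp (by fun_prop) fun x _ => isHermitian_diagonal x

end Entropic
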